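/- arXiv:2512.10717 — 3 statements merged into one kernel-verified Lean document; each statement's English description precedes it below -/
import Mathlib

section
/- Let a, b, ψ, β, β', γ be positive real numbers, and write f_{s,r}(x) = (r^s / Γ(s)) · x^(s-1) · exp(-r·x) for the Gamma(s, r) density. Then the joint density of the triple (β, γ, β') defined by β ~ Gamma(a, b), γ | β ~ Gamma(ψ, β), β' | γ ~ Gamma(a+ψ, b+γ) is symmetric in β and β'; that is, for all positive β, β', γ: f_{a,b}(β) · f_{ψ,β}(γ) · f_{a+ψ,b+γ}(β') = f_{a,b}(β') · f_{ψ,β'}(γ) · f_{a+ψ,b+γ}(β). -/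
/-- The Gamma(s, r) probability density at x. -/
noncomputable def gammaDensity (s r x : ℝ) : ℝ :=
  (r ^ s / Real.Gamma s) * x ^ (s - 1) * Real.exp (-(r * x))

/-- Symmetry of the joint density of (β, γ, β') under
β ~ Gamma(a,b), γ | β ~ Gamma(ψ,β), β' | γ ~ Gamma(a+ψ, b+γ). -/
theorem joint_density_symmetric (a b ψ β β' γ : ℝ)
    (ha : 0 < a) (hb : 0 < b) (hψ : 0 < ψ)
    (hβ : 0 < β) (hβ' : 0 < β') (hγ : 0 < γ) :
    gammaDensity a b β * gammaDensity ψ β γ * gammaDensity (a + ψ) (b + γ) β'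
      = gammaDensity a b β' * gammaDensity ψ β' γ *
        gammaDensity (a + ψ) (b + γ) β := by
  have hpow : ∀ x : ℝ, 0 < x → x ^ (a + ψ - 1) = x ^ (a - 1) * x ^ ψ := fun x hx => by
    rw [← Real.rpow_add hx]
    ring_nf
  have hexp : Real.exp (-(b * β)) * Real.exp (-(β * γ)) * Real.exp (-((b + γ) * β'))
      = Real.exp (-(b * β')) * Real.exp (-(β' * γ)) * Real.exp (-((b + γ) * β)) := by
    simp only [← Real.exp_add]
    ring_nf
  simp only [gammaDensity, hpow β hβ, hpow β' hβ']
  linear_combination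
    (b ^ a / Real.Gamma a) * β ^ (a - 1) * (β ^ ψ / Real.Gamma ψ) * γ ^ (ψ - 1) *
      ((b + γ) ^ (a + ψ) / Real.Gamma (a + ψ)) * (β' ^ (a - 1) * β' ^ ψ) * hexp
end

section
/- Let a, b, ψ, β' be positive real numbers, and write f_{s,r}(x) = (r^s / Γ(s)) · x^(s-1) · exp(-r·x) for the Gamma(s, r) density. Then ∫₀^∞ ∫₀^∞ f_{a+ψ, b+γ}(β') · f_{ψ, β}(γ) · f_{a,b}(β) dβ dγ = f_{a,b}(β'). That is, if β ~ Gamma(a,b), γ | β ~ Gamma(ψ, β) and β' | γ ~ Gamma(a+ψ, b+γ), then marginally β' ~ Gamma(a,b): the transition of the latent Markov process preserves the Gamma(a,b) marginal. -/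
open MeasureTheory

theorem integral_gammaDensity {s r : ℝ} (hs : 0 < s) (hr : 0 < r) :
    ∫ x in Set.Ioi (0 : ℝ), gammaDensity s r x = 1 := by
  simp only [gammaDensity, mul_assoc]
  rw [integral_const_mul, Real.integral_rpow_mul_exp_neg_mul_Ioi hs hr,
    Real.div_rpow zero_le_one hr.le, Real.one_rpow]
  have := (Real.Gamma_pos_of_pos hs).ne'
  have := (Real.rpow_pos_of_pos hr s).ne'
  field_simp

/-- The pair `β ~ Gamma(a, b)`, `γ | β ~ Gamma(ψ, β)` has joint density proportional, as a function
of `β`, to the `Gamma(a + ψ, b + γ)` density. -/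
theorem gammaDensity_mul_gammaDensity {x : ℝ} (hx : 0 < x) (a b ψ γ : ℝ) :
    gammaDensity ψ x γ * gammaDensity a b x =
      γ ^ (ψ - 1) / Real.Gamma ψ * (b ^ a / Real.Gamma a) *
        (x ^ (a + ψ - 1) * Real.exp (-((b + γ) * x))) := by
  have hpow : x ^ (a + ψ - 1) = x ^ ψ * x ^ (a - 1) := by
    rw [← Real.rpow_add hx]
    ring_nf
  have hexp : Real.exp (-((b + γ) * x)) = Real.exp (-(x * γ)) * Real.exp (-(b * x)) := by
    rw [← Real.exp_add]
    ring_nf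
  rw [hpow, hexp, gammaDensity, gammaDensity]
  ring

/-- Detailed balance: the transition `β → γ → β'` is reversible with respect to `Gamma(a, b)`. -/
theorem gammaDensity_detailed_balance {x y : ℝ} (hx : 0 < x) (hy : 0 < y) (a b ψ γ : ℝ) :
    gammaDensity (a + ψ) (b + γ) y * gammaDensity ψ x γ * gammaDensity a b x =
      gammaDensity ψ y γ * gammaDensity a b y * gammaDensity (a + ψ) (b + γ) x := by
  rw [mul_assoc, gammaDensity_mul_gammaDensity hx, gammaDensity_mul_gammaDensity hy, gammaDensity,
    gammaDensity]
  ring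

/-- The transition of the latent Markov process preserves the Gamma(a,b)
marginal: integrating out β and γ recovers the Gamma(a,b) density at β'. -/
theorem markov_transition_preserves_gamma_marginal (a b ψ β' : ℝ)
    (ha : 0 < a) (hb : 0 < b) (hψ : 0 < ψ) (hβ' : 0 < β') :
    ∫ γ in Set.Ioi (0 : ℝ), ∫ β in Set.Ioi (0 : ℝ),
        gammaDensity (a + ψ) (b + γ) β' * gammaDensity ψ β γ * gammaDensity a b β
      = gammaDensity a b β' := by
  have inner : ∀ γ ∈ Set.Ioi (0 : ℝ), ∫ β in Set.Ioi (0 : ℝ),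
      gammaDensity (a + ψ) (b + γ) β' * gammaDensity ψ β γ * gammaDensity a b β =
        gammaDensity ψ β' γ * gammaDensity a b β' := by
    intro γ hγ
    rw [setIntegral_congr_fun measurableSet_Ioi
        fun β hβ => gammaDensity_detailed_balance hβ hβ' a b ψ γ,
      integral_const_mul, integral_gammaDensity (add_pos ha hψ) (add_pos hb hγ), mul_one]
  rw [setIntegral_congr_fun measurableSet_Ioi inner, integral_mul_const,
    integral_gammaDensity hψ hβ', one_mul]
end

section
/- Let σ ∈ (0, 1), τ > 0, α > 0 and L > 0, and set t = (σ·L/α)^(1/σ). Then the exponentially tilted BFRY function g(w) = σ · w^(-1-σ) · exp(-τ·w) · (1 − exp(-t·w)) / (Γ(1-σ) · ((τ + t)^σ − τ^σ)) is a probability density on (0, ∞): g(w) ≥ 0 for all w > 0 (in particular (τ + t)^σ − τ^σ > 0) and ∫₀^∞ g(w) dw = 1. -/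
open MeasureTheory

open Set Filter Topology

lemma one_sub_exp_neg_mul_mem_Icc {t w : ℝ} (ht : 0 < t) (hw : 0 < w) :
    1 - Real.exp (-(t * w)) ∈ Icc 0 (t * w) := by
  have h₁ : Real.exp (-(t * w)) ≤ 1 := Real.exp_le_one_iff.mpr (by nlinarith [mul_pos ht hw])
  have h₂ := Real.one_sub_le_exp_neg (t * w)
  constructor <;> linarith

lemma integrableOn_rpow_neg_mul_exp_neg_mul {σ r : ℝ} (hσ : σ < 1) (hr : 0 < r) :
    IntegrableOn (fun w : ℝ => w ^ (-σ) * Real.exp (-(r * w))) (Ioi 0) := by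
  have h := integrableOn_rpow_mul_exp_neg_mul_rpow (p := 1) (s := -σ) (b := r)
    (by linarith) one_pos hr
  simpa only [Real.rpow_one, neg_mul] using h

lemma mul_integral_rpow_neg_mul_exp_neg_mul {σ r : ℝ} (hσ : σ < 1) (hr : 0 < r) :
    r * ∫ w in Ioi (0 : ℝ), w ^ (-σ) * Real.exp (-(r * w)) = Real.Gamma (1 - σ) * r ^ σ := by
  have h := Real.integral_rpow_mul_exp_neg_mul_Ioi (a := 1 - σ) (r := r) (by linarith) hr
  rw [show (1 - σ - 1 : ℝ) = -σ by ring] at h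
  rw [h, one_div, Real.inv_rpow hr.le, Real.rpow_sub hr, Real.rpow_one]
  have := (Real.rpow_pos_of_pos hr σ).ne'
  field_simp

lemma integrableOn_rpow_mul_exp_mul_one_sub_exp {σ τ t : ℝ} (hσ : σ < 1) (hτ : 0 < τ)
    (ht : 0 < t) :
    IntegrableOn (fun w : ℝ => w ^ (-1 - σ) * Real.exp (-(τ * w)) * (1 - Real.exp (-(t * w))))
      (Ioi 0) := by
  refine Integrable.mono' ((integrableOn_rpow_neg_mul_exp_neg_mul hσ hτ).const_mul t)
    (by fun_prop) ?_
  filter_upwards [ae_restrict_mem measurableSet_Ioi] with w (hw : 0 < w)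
  obtain ⟨h₀, h₁⟩ := one_sub_exp_neg_mul_mem_Icc ht hw
  have hp := Real.rpow_pos_of_pos hw (-1 - σ)
  have he : w ^ (-σ) = w ^ (-1 - σ) * w := by
    rw [← Real.rpow_add_one hw.ne']; ring_nf
  rw [Real.norm_of_nonneg (by positivity), he]
  calc _ ≤ w ^ (-1 - σ) * Real.exp (-(τ * w)) * (t * w) := by gcongr
    _ = _ := by ring

/-- The normalizing constant of the exponentially tilted BFRY distribution. -/
lemma integral_rpow_mul_exp_mul_one_sub_exp {σ τ t : ℝ} (hσ₀ : 0 < σ) (hσ : σ < 1) (hτ : 0 < τ)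
    (ht : 0 < t) :
    ∫ w in Ioi (0 : ℝ), σ * w ^ (-1 - σ) * Real.exp (-(τ * w)) * (1 - Real.exp (-(t * w))) =
      Real.Gamma (1 - σ) * ((τ + t) ^ σ - τ ^ σ) := by
  have hb : 0 < τ + t := add_pos hτ ht
  let u : ℝ → ℝ := fun w => w ^ (-σ)
  let v : ℝ → ℝ := fun w => Real.exp (-(τ * w)) * (1 - Real.exp (-(t * w)))
  let u' : ℝ → ℝ := fun w => -σ * w ^ (-σ - 1)
  let v' : ℝ → ℝ := fun w =>
    (τ + t) * Real.exp (-((τ + t) * w)) - τ * Real.exp (-(τ * w))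
  have hexp (w : ℝ) : Real.exp (-((τ + t) * w)) = Real.exp (-(τ * w)) * Real.exp (-(t * w)) := by
    rw [← Real.exp_add]; ring_nf
  have hderiv (r w : ℝ) :
      HasDerivAt (fun w => Real.exp (-(r * w))) (Real.exp (-(r * w)) * (-r)) w := by
    simpa using (((hasDerivAt_id w).const_mul r).neg).exp
  have hu : ∀ w ∈ Ioi (0 : ℝ), HasDerivAt u (u' w) w := fun w hw =>
    Real.hasDerivAt_rpow_const (Or.inl (ne_of_gt hw))
  have hv : ∀ w ∈ Ioi (0 : ℝ), HasDerivAt v (v' w) w := fun w _ => by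
    refine ((hderiv τ w).mul ((hderiv t w).const_sub 1)).congr_deriv ?_
    simp only [v', hexp]
    ring
  have hIb := (integrableOn_rpow_neg_mul_exp_neg_mul hσ hb).const_mul (τ + t)
  have hIτ := (integrableOn_rpow_neg_mul_exp_neg_mul hσ hτ).const_mul τ
  have huv'_eq : u * v' = fun w => (τ + t) * (w ^ (-σ) * Real.exp (-((τ + t) * w))) -
      τ * (w ^ (-σ) * Real.exp (-(τ * w))) := by
    funext w
    simp only [Pi.mul_apply, u, v']
    ring
  have hu'v_eq : u' * v = fun w =>
      -σ * (w ^ (-1 - σ) * Real.exp (-(τ * w)) * (1 - Real.exp (-(t * w)))) := by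
    funext w
    simp only [Pi.mul_apply, u', v, show -σ - 1 = -1 - σ by ring]
    ring
  have huv' : IntegrableOn (u * v') (Ioi 0) := huv'_eq ▸ hIb.sub hIτ
  have hu'v : IntegrableOn (u' * v) (Ioi 0) :=
    hu'v_eq ▸ (integrableOn_rpow_mul_exp_mul_one_sub_exp hσ hτ ht).const_mul (-σ)
  have hv_mem (w : ℝ) (hw : 0 < w) : 0 ≤ v w ∧ v w ≤ 1 ∧ v w ≤ t * w := by
    obtain ⟨h₀, h₁⟩ := one_sub_exp_neg_mul_mem_Icc ht hw
    have hτw : Real.exp (-(τ * w)) ≤ 1 :=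
      Real.exp_le_one_iff.mpr (by nlinarith [mul_pos hτ hw])
    have hle : v w ≤ 1 - Real.exp (-(t * w)) := mul_le_of_le_one_left h₀ hτw
    exact ⟨mul_nonneg (Real.exp_pos _).le h₀, by linarith [Real.exp_pos (-(t * w))],
      hle.trans h₁⟩
  have h_zero : Tendsto (u * v) (𝓝[>] 0) (𝓝 0) := by
    have hlim : Tendsto (fun w : ℝ => t * w ^ (1 - σ)) (𝓝[>] 0) (𝓝 0) := by
      have hc : Continuous fun w : ℝ => t * w ^ (1 - σ) :=
        (Real.continuous_rpow_const (by linarith)).const_mul t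
      simpa [Real.zero_rpow (sub_pos.mpr hσ).ne'] using
        (hc.tendsto 0).mono_left nhdsWithin_le_nhds
    refine tendsto_of_tendsto_of_tendsto_of_le_of_le' tendsto_const_nhds hlim ?_ ?_ <;>
      filter_upwards [self_mem_nhdsWithin] with w (hw : 0 < w)
    · exact mul_nonneg (Real.rpow_nonneg hw.le _) (hv_mem w hw).1
    · calc w ^ (-σ) * v w ≤ w ^ (-σ) * (t * w) := by gcongr; exact (hv_mem w hw).2.2
        _ = t * w ^ (1 - σ) := by
          rw [show 1 - σ = -σ + 1 by ring, Real.rpow_add_one hw.ne']; ring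
  have h_infty : Tendsto (u * v) atTop (𝓝 0) := by
    refine tendsto_of_tendsto_of_tendsto_of_le_of_le' tendsto_const_nhds
      (tendsto_rpow_neg_atTop hσ₀) ?_ ?_ <;>
      filter_upwards [eventually_gt_atTop 0] with w hw
    · exact mul_nonneg (Real.rpow_nonneg hw.le _) (hv_mem w hw).1
    · exact mul_le_of_le_one_right (Real.rpow_nonneg hw.le _) (hv_mem w hw).2.1
  have hparts := integral_Ioi_mul_deriv_eq_deriv_mul hu hv huv' hu'v h_zero h_infty
  have hright : ∫ w in Ioi (0 : ℝ), u w * v' w =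
      Real.Gamma (1 - σ) * ((τ + t) ^ σ - τ ^ σ) := by
    calc _ = ∫ w in Ioi (0 : ℝ), ((τ + t) * (w ^ (-σ) * Real.exp (-((τ + t) * w))) -
          τ * (w ^ (-σ) * Real.exp (-(τ * w)))) :=
        integral_congr_ae (Eventually.of_forall fun w => congrFun huv'_eq w)
      _ = _ := by
        rw [integral_sub hIb hIτ, integral_const_mul, integral_const_mul,
          mul_integral_rpow_neg_mul_exp_neg_mul hσ hb,
          mul_integral_rpow_neg_mul_exp_neg_mul hσ hτ, mul_sub]
  rw [← hright, hparts, sub_zero, zero_sub, ← integral_neg]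
  congr 1
  funext w
  simp only [u', v, show -σ - 1 = -1 - σ by ring]
  ring

/-- The exponentially tilted BFRY function is a probability density on (0, ∞). -/
theorem etBFRY_is_probability_density (σ τ α L : ℝ)
    (hσ : σ ∈ Set.Ioo (0 : ℝ) 1) (hτ : 0 < τ) (hα : 0 < α) (hL : 0 < L) :
    let t := (σ * L / α) ^ (1 / σ)
    let g := fun w : ℝ =>
      σ * w ^ (-1 - σ) * Real.exp (-(τ * w)) * (1 - Real.exp (-(t * w))) /
        (Real.Gamma (1 - σ) * ((τ + t) ^ σ - τ ^ σ))
    0 < (τ + t) ^ σ - τ ^ σ ∧ (∀ w > (0 : ℝ), 0 ≤ g w) ∧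
      ∫ w in Set.Ioi (0 : ℝ), g w = 1 := by
  intro t g
  obtain ⟨hσ₀, hσ₁⟩ := hσ
  have ht : 0 < t := Real.rpow_pos_of_pos (by positivity) _
  have hpos : 0 < (τ + t) ^ σ - τ ^ σ :=
    sub_pos.mpr (Real.rpow_lt_rpow hτ.le (lt_add_of_pos_right τ ht) hσ₀)
  have hΓ : 0 < Real.Gamma (1 - σ) := Real.Gamma_pos_of_pos (sub_pos.mpr hσ₁)
  refine ⟨hpos, fun w hw => ?_, ?_⟩
  · have h₀ := (one_sub_exp_neg_mul_mem_Icc ht hw).1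
    have hp := Real.rpow_pos_of_pos hw (-1 - σ)
    exact div_nonneg (by positivity) (mul_pos hΓ hpos).le
  · rw [integral_div, integral_rpow_mul_exp_mul_one_sub_exp hσ₀ hσ₁ hτ ht,
      div_self (mul_pos hΓ hpos).ne']
end
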